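/- For every translationally invariant eigenstate |j⟩ of H with eigenvalue E_j, the entanglement entropy of its reduced density matrix on subsystem A satisfies S(ρ_{j,A}) ≤ m·ln 2 − f·E_j²/(4n). -/

import Mathlib

open Finset Matrix
open scoped ComplexOrder

noncomputable section

/-- The Hilbert space of a chain of `n` spin-1/2's, `(ℂ²)^{⊗n}`, in the computational basis:
a state assigns an amplitude to each configuration `Fin n → Fin 2`. -/
abbrev QState (n : ℕ) : Type := (Fin n → Fin 2) → ℂ

/-- Operators on the chain of `n` spin-1/2's. -/
abbrev QOp (n : ℕ) : Type := Matrix (Fin n → Fin 2) (Fin n → Fin 2) ℂ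

/-- von Neumann entropy `S(ρ) = -tr(ρ ln ρ)` (natural logarithm), via eigenvalues. -/
noncomputable def vnEntropy {ι : Type} [Fintype ι] [DecidableEq ι] (ρ : Matrix ι ι ℂ) : ℝ := by
  classical
  exact if h : ρ.IsHermitian then -∑ i, h.eigenvalues i * Real.log (h.eigenvalues i) else 0

/-- Operator norm (`ℓ² → ℓ²`) of a matrix. -/
noncomputable def opNorm {ι : Type} [Fintype ι] [DecidableEq ι] (M : Matrix ι ι ℂ) : ℝ :=
  ‖LinearMap.toContinuousLinearMap (Matrix.toEuclideanLin M)‖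

/-- Combine a configuration of the first `m` sites with one of the remaining `n - m` sites. -/
def joinCfg (n m : ℕ) (a : Fin m → Fin 2) (b : Fin (n - m) → Fin 2) : Fin n → Fin 2 :=
  fun i => if hi : (i : ℕ) < m then a ⟨i, hi⟩ else b ⟨(i : ℕ) - m, by have := i.isLt; omega⟩

/-- Reduced density matrix `ρ_A = tr_B |ψ⟩⟨ψ|` of a pure state, where `A` consists of the
first `m` spins and `B` of the remaining `n - m` spins. -/
noncomputable def rdm (n m : ℕ) (ψ : QState n) :
    Matrix (Fin m → Fin 2) (Fin m → Fin 2) ℂ :=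
  fun a a' => ∑ b : Fin (n - m) → Fin 2,
    ψ (joinCfg n m a b) * (starRingEnd ℂ) (ψ (joinCfg n m a' b))

/-- Entanglement entropy of a pure state between the first `m` spins and the rest. -/
noncomputable def entEntropy (n m : ℕ) (ψ : QState n) : ℝ := vnEntropy (rdm n m ψ)

/-- The cyclic successor `i + 1 (mod n)` of a site of the periodic chain. -/
def finSucc {n : ℕ} (i : Fin n) : Fin n := ⟨((i : ℕ) + 1) % n, Nat.mod_lt _ i.pos⟩

/-- Translation (cyclic shift by one site) acting on configurations. -/
def shiftCfg {n : ℕ} (σ : Fin n → Fin 2) : Fin n → Fin 2 := fun i => σ (finSucc i)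

/-- `M` acts only on the sites in `S`, i.e. `M = K ⊗ 1` with `K` supported on `S`:
matrix elements vanish unless the configurations agree off `S`, and they depend only on
the restriction of the configurations to `S`. -/
def ActsOn {n : ℕ} (S : Finset (Fin n)) (M : QOp n) : Prop :=
  (∀ σ τ : Fin n → Fin 2, (∃ i ∉ S, σ i ≠ τ i) → M σ τ = 0) ∧
  (∀ σ τ σ' τ' : Fin n → Fin 2, (∀ i ∈ S, σ i = σ' i) → (∀ i ∈ S, τ i = τ' i) →
    (∀ i ∉ S, σ i = τ i) → (∀ i ∉ S, σ' i = τ' i) → M σ τ = M σ' τ')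


lemma hoeff {β : Type} [Fintype β] (lam : β → ℝ) (t : ℝ) (h1 : ∀ x, |lam x| ≤ 1)
    (h0 : ∑ x, lam x = 0) :
    ∑ x, Real.exp (t * lam x) ≤ Fintype.card β * Real.exp (t ^ 2 / 2) := by
  have key : ∀ x, Real.exp (t * lam x) ≤ Real.cosh t + lam x * Real.sinh t := by
    intro x
    have := abs_le.mp (h1 x)
    have hc := convexOn_exp.2 (Set.mem_univ t) (Set.mem_univ (-t))
      (show 0 ≤ (1 + lam x) / 2 by linarith) (show 0 ≤ (1 - lam x) / 2 by linarith) (by ring)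
    simp only [smul_eq_mul] at hc
    rw [Real.cosh_eq, Real.sinh_eq]
    have e1 : (1 + lam x) / 2 * t + (1 - lam x) / 2 * -t = t * lam x := by ring
    rw [e1] at hc
    linarith
  calc _ ≤ ∑ x, (Real.cosh t + lam x * Real.sinh t) := Finset.sum_le_sum fun x _ => key x
    _ = Fintype.card β * Real.cosh t := by
      rw [Finset.sum_add_distrib, ← Finset.sum_mul, h0]; simp
    _ ≤ _ := by
      gcongr
      exact Real.cosh_le_exp_half_sq t

lemma klein_aux (p q : ℝ) (hp : 0 ≤ p) (hq : 0 < q) : p - q ≤ p * Real.log p - p * Real.log q := by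
  rcases hp.eq_or_lt with rfl | hp
  · simp; exact hq.le
  · have := Real.log_le_sub_one_of_pos (div_pos hq hp)
    rw [Real.log_div hq.ne' hp.ne'] at this
    have h2 := mul_le_mul_of_nonneg_left this hp.le
    have : p * (q / p - 1) = q - p := by field_simp
    nlinarith

lemma entropy_le {ι κ : Type} [Fintype ι] [DecidableEq ι] [Fintype κ] [DecidableEq κ]
    (ρ : Matrix ι ι ℂ) (hρ : ρ.PosSemidef) (htr : ρ.trace = 1)
    (W : Matrix ι κ ℂ) (hW1 : Wᴴ * W = 1) (hW2 : W * Wᴴ = 1)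
    (q : κ → ℝ) (hq : ∀ l, 0 < q l) (hq1 : ∑ l, q l = 1) :
    vnEntropy ρ ≤ -∑ l, Real.log (q l) * ((Wᴴ * ρ * W) l l).re := by
  have h := hρ.isHermitian
  have e0 : vnEntropy ρ = -∑ i, h.eigenvalues i * Real.log (h.eigenvalues i) := by
    simp only [vnEntropy]
    rw [dif_pos h]
  rw [e0]
  set p := h.eigenvalues with hp
  have hp0 : ∀ i, 0 ≤ p i := hρ.eigenvalues_nonneg
  set V : Matrix ι ι ℂ := (h.eigenvectorUnitary : Matrix ι ι ℂ) with hV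
  have hV1 : Vᴴ * V = 1 := by
    have := (Matrix.mem_unitaryGroup_iff' (A := V)).1 h.eigenvectorUnitary.2
    exact this
  have hV2 : V * Vᴴ = 1 := by
    have := (Matrix.mem_unitaryGroup_iff (A := V)).1 h.eigenvectorUnitary.2
    exact this
  have hspec : ρ = V * diagonal (fun i => (p i : ℂ)) * Vᴴ := by
    have := h.spectral_theorem
    rw [Unitary.conjStarAlgAut_apply] at this
    exact this
  set D : Matrix κ ι ℂ := Wᴴ * V with hD
  have hD1 : D * Dᴴ = 1 := by
    rw [hD, conjTranspose_mul, conjTranspose_conjTranspose, Matrix.mul_assoc, ← Matrix.mul_assoc V,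
      hV2, Matrix.one_mul, hW1]
  have hD2 : Dᴴ * D = 1 := by
    rw [hD, conjTranspose_mul, conjTranspose_conjTranspose, Matrix.mul_assoc, ← Matrix.mul_assoc W,
      hW2, Matrix.one_mul, hV1]
  have hr : Wᴴ * ρ * W = D * diagonal (fun i => (p i : ℂ)) * Dᴴ := by
    rw [hD, conjTranspose_mul, conjTranspose_conjTranspose, hspec]
    simp only [Matrix.mul_assoc]
  have hrl : ∀ l, ((Wᴴ * ρ * W) l l).re = ∑ i, p i * Complex.normSq (D l i) := by
    intro l
    rw [hr, Matrix.mul_apply, Complex.re_sum]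
    refine Finset.sum_congr rfl fun i _ => ?_
    rw [Matrix.mul_diagonal, conjTranspose_apply]
    simp [Complex.normSq_apply]
    ring
  have hP1 : ∀ l, ∑ i, Complex.normSq (D l i) = 1 := by
    intro l
    have := congrFun (congrFun hD1 l) l
    rw [Matrix.mul_apply] at this
    simp only [conjTranspose_apply, one_apply_eq, RCLike.star_def, Complex.mul_conj] at this
    exact_mod_cast this
  have hP2 : ∀ i, ∑ l, Complex.normSq (D l i) = 1 := by
    intro l
    have := congrFun (congrFun hD2 l) l
    rw [Matrix.mul_apply] at this
    simp only [conjTranspose_apply, one_apply_eq, RCLike.star_def, ← Complex.normSq_eq_conj_mul_self] at this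
    exact_mod_cast this
  have hps : ∑ i, p i = 1 := by
    have := h.trace_eq_sum_eigenvalues
    rw [htr] at this
    have h2 : ((∑ i, p i : ℝ) : ℂ) = 1 := by push_cast; exact this.symm
    exact_mod_cast h2
  have main : 0 ≤ ∑ i, ∑ l, Complex.normSq (D l i) * (p i * Real.log (p i) - p i * Real.log (q l)) := by
    calc (0:ℝ) = ∑ i, ∑ l, Complex.normSq (D l i) * (p i - q l) := by
          simp only [mul_sub, Finset.sum_sub_distrib]
          rw [Finset.sum_comm (f := fun i l => Complex.normSq (D l i) * q l)]
          simp only [← Finset.sum_mul, hP1, hP2, one_mul, hps, hq1, sub_self]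
      _ ≤ _ := by
          exact Finset.sum_le_sum fun i _ => Finset.sum_le_sum fun l _ =>
            mul_le_mul_of_nonneg_left (klein_aux _ _ (hp0 i) (hq l)) (Complex.normSq_nonneg _)
  simp only [mul_sub, Finset.sum_sub_distrib] at main
  rw [Finset.sum_comm (f := fun i l => Complex.normSq (D l i) * (p i * Real.log (q l)))] at main
  simp only [← Finset.sum_mul, hP2, one_mul] at main
  simp only [hrl, Finset.mul_sum]
  have : ∑ l, ∑ i, Complex.normSq (D l i) * (p i * Real.log (q l)) =
      ∑ l, ∑ i, Real.log (q l) * (p i * Complex.normSq (D l i)) :=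
    Finset.sum_congr rfl fun _ _ => Finset.sum_congr rfl fun _ _ => by ring
  linarith

lemma product_bound {ι K β : Type} [Fintype ι] [DecidableEq ι] [Fintype K] [DecidableEq K]
    [Fintype β] [DecidableEq β] [Nonempty β] (ε : ι ≃ (K → β))
    (ρ : Matrix ι ι ℂ) (hρ : ρ.PosSemidef) (htr : ρ.trace = 1)
    (h : K → Matrix β β ℂ) (hh : ∀ k, (h k).IsHermitian) (htr0 : ∀ k, (h k).trace = 0)
    (hev : ∀ k x, |(hh k).eigenvalues x| ≤ 1)
    (e : ℝ)
    (he : ∀ k, ∑ a, ∑ a', ρ a a' * (∏ k', if k' = k then h k' (ε a' k') (ε a k') else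
      if ε a' k' = ε a k' then 1 else 0) = (e : ℂ)) :
    vnEntropy ρ ≤ Fintype.card K * (Real.log (Fintype.card β) - e ^ 2 / 2) := by
  set lam : K → β → ℝ := fun k x => (hh k).eigenvalues x with hlam
  set U : K → Matrix β β ℂ := fun k => ((hh k).eigenvectorUnitary : Matrix β β ℂ) with hU
  have hU1 : ∀ k, (U k)ᴴ * (U k) = 1 := fun k =>
    (Matrix.mem_unitaryGroup_iff' (A := U k)).1 (hh k).eigenvectorUnitary.2
  have hU2 : ∀ k, (U k) * (U k)ᴴ = 1 := fun k =>
    (Matrix.mem_unitaryGroup_iff (A := U k)).1 (hh k).eigenvectorUnitary.2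
  have hspec : ∀ k, h k = U k * diagonal (fun i => (lam k i : ℂ)) * (U k)ᴴ := by
    intro k
    have := (hh k).spectral_theorem
    rw [Unitary.conjStarAlgAut_apply] at this
    exact this
  have hlam0 : ∀ k, ∑ x, lam k x = 0 := by
    intro k
    have := (hh k).trace_eq_sum_eigenvalues
    rw [htr0] at this
    have h2 : ((∑ i, lam k i : ℝ) : ℂ) = 0 := by push_cast; exact this.symm
    exact_mod_cast h2
  set W : Matrix ι (K → β) ℂ := Matrix.of fun a l => ∏ k, U k (ε a k) (l k) with hW
  have hW1 : Wᴴ * W = 1 := by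
    ext l l'
    rw [Matrix.mul_apply]
    simp only [hW, conjTranspose_apply, of_apply, star_prod, ← Finset.prod_mul_distrib]
    rw [Equiv.sum_comp ε (fun s => ∏ k, star (U k (s k) (l k)) * U k (s k) (l' k)),
      ← Fintype.prod_sum (fun k x => star (U k x (l k)) * U k x (l' k))]
    have : ∀ k, ∑ x, star (U k x (l k)) * U k x (l' k) = if l k = l' k then 1 else 0 := by
      intro k
      have := congrFun (congrFun (hU1 k) (l k)) (l' k)
      rw [Matrix.mul_apply, Matrix.one_apply] at this
      exact this
    simp only [this, Matrix.one_apply]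
    rw [Finset.prod_ite_zero]
    simp [funext_iff]
  have hW2 : W * Wᴴ = 1 := by
    ext a a'
    rw [Matrix.mul_apply]
    simp only [hW, conjTranspose_apply, of_apply, star_prod, ← Finset.prod_mul_distrib]
    rw [← Fintype.prod_sum (fun k x => U k (ε a k) x * star (U k (ε a' k) x))]
    have : ∀ k, ∑ x, U k (ε a k) x * star (U k (ε a' k) x) = if ε a k = ε a' k then 1 else 0 := by
      intro k
      have := congrFun (congrFun (hU2 k) (ε a k)) (ε a' k)
      rw [Matrix.mul_apply, Matrix.one_apply] at this
      exact this
    simp only [this, Matrix.one_apply]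
    rw [Finset.prod_ite_zero]
    simp [← funext_iff]
  have hG : ∀ k a a', ∑ l : K → β, (lam k (l k) : ℂ) * (W a' l * star (W a l)) =
      ∏ k', if k' = k then h k' (ε a' k') (ε a k') else
      if ε a' k' = ε a k' then 1 else 0 := by
    intro k a a'
    have e1 : ∀ l : K → β, (lam k (l k) : ℂ) * (W a' l * star (W a l)) =
      ∏ k', ((if k' = k then (lam k' (l k') : ℂ) else 1) * (U k' (ε a' k') (l k') * star (U k' (ε a k') (l k')))) := by
      intro l
      rw [Finset.prod_mul_distrib, Finset.prod_mul_distrib]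
      simp only [hW, of_apply, star_prod, Finset.prod_ite_eq', Finset.mem_univ, if_true]
    simp only [e1]
    rw [← Fintype.prod_sum (fun k' x => ((if k' = k then (lam k' x : ℂ) else 1) * (U k' (ε a' k') x * star (U k' (ε a k') x))))]
    refine Finset.prod_congr rfl fun k' _ => ?_
    split_ifs with h1 h2
    · conv_rhs => rw [hspec k']
      rw [Matrix.mul_apply]
      refine Finset.sum_congr rfl fun x _ => ?_
      rw [Matrix.mul_diagonal, conjTranspose_apply]; ring
    · have := congrFun (congrFun (hU2 k') (ε a' k')) (ε a k')
      rw [Matrix.mul_apply, Matrix.one_apply, if_pos h2] at this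
      simpa using this
    · have := congrFun (congrFun (hU2 k') (ε a' k')) (ε a k')
      rw [Matrix.mul_apply, Matrix.one_apply, if_neg h2] at this
      simpa using this
  set r : (K → β) → ℝ := fun l => ((Wᴴ * ρ * W) l l).re with hr
  have hr1 : ∑ l, r l = 1 := by
    have : (Wᴴ * ρ * W).trace = 1 := by
      rw [Matrix.trace_mul_comm, ← Matrix.mul_assoc, hW2, Matrix.one_mul, htr]
    have h2 := congrArg Complex.re this
    rw [Matrix.trace, Complex.re_sum] at h2
    exact h2
  have hre : ∀ k, ∑ l, lam k (l k) * r l = e := by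
    intro k
    have h1 : ∑ l : K → β, (lam k (l k) : ℂ) * (Wᴴ * ρ * W) l l = e := by
      rw [← he k]
      simp only [← hG, Matrix.mul_apply, conjTranspose_apply, Finset.mul_sum, Finset.sum_mul]
      rw [Finset.sum_comm]
      rw [Finset.sum_congr rfl fun a _ => Finset.sum_comm]
      rw [Finset.sum_comm]
      refine Finset.sum_congr rfl fun a _ => Finset.sum_congr rfl fun a' _ =>
        Finset.sum_congr rfl fun l _ => by ring
    have h2 := congrArg Complex.re h1
    rw [Complex.re_sum] at h2
    simpa [Complex.re_ofReal_mul] using h2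
  set z : K → ℝ := fun k => ∑ x, Real.exp (e * lam k x) with hz
  have hzpos : ∀ k, 0 < z k := fun k => Finset.sum_pos (fun _ _ => Real.exp_pos _) Finset.univ_nonempty
  have hzle : ∀ k, Real.log (z k) ≤ Real.log (Fintype.card β) + e ^ 2 / 2 := by
    intro k
    have := Real.log_le_log (hzpos k) (hoeff (lam k) e (hev k) (hlam0 k))
    rw [Real.log_mul (by simp) (Real.exp_pos _).ne', Real.log_exp] at this
    exact this
  have hmain := entropy_le ρ hρ htr W hW1 hW2 (fun l => ∏ k, (Real.exp (e * lam k (l k)) / z k))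
    (fun l => Finset.prod_pos fun k _ => div_pos (Real.exp_pos _) (hzpos k))
    (by
      rw [← Fintype.prod_sum (fun k x => Real.exp (e * lam k x) / z k)]
      refine Finset.prod_eq_one fun k _ => ?_
      rw [← Finset.sum_div]
      exact div_self (hzpos k).ne')
  have hlog : ∀ l : K → β, Real.log (∏ k, (Real.exp (e * lam k (l k)) / z k)) =
      ∑ k, (e * lam k (l k) - Real.log (z k)) := by
    intro l
    rw [Real.log_prod (fun k _ => (div_pos (Real.exp_pos _) (hzpos k)).ne')]
    refine Finset.sum_congr rfl fun k _ => ?_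
    rw [Real.log_div (Real.exp_pos _).ne' (hzpos k).ne', Real.log_exp]
  simp only [hlog] at hmain
  refine hmain.trans ?_
  have h3 : ∑ l, (∑ k, (e * lam k (l k) - Real.log (z k))) * r l = ∑ k, (e * e - Real.log (z k)) := by
    simp only [Finset.sum_mul]
    rw [Finset.sum_comm]
    refine Finset.sum_congr rfl fun k _ => ?_
    simp only [sub_mul, Finset.sum_sub_distrib, mul_assoc, ← Finset.mul_sum, hre, hr1, mul_one]
  change -∑ l, (∑ k, (e * lam k (l k) - Real.log (z k))) * r l ≤ _
  rw [h3, ← Finset.sum_neg_distrib]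
  calc _ ≤ ∑ k : K, (Real.log (Fintype.card β) - e ^ 2 / 2) := by
        refine Finset.sum_le_sum fun k _ => ?_
        have := hzle k
        nlinarith
    _ = _ := by simp [mul_sub]

lemma actsOn_mono {n : ℕ} {S T : Finset (Fin n)} (hST : S ⊆ T) {M : QOp n} (h : ActsOn S M) :
    ActsOn T M := by
  refine ⟨fun σ τ ⟨i, hi, hne⟩ => h.1 σ τ ⟨i, fun hS => hi (hST hS), hne⟩, ?_⟩
  intro σ τ σ' τ' h1 h2 h3 h4
  by_cases hc : ∀ i ∉ S, σ i = τ i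
  · refine h.2 σ τ σ' τ' (fun i hi => h1 i (hST hi)) (fun i hi => h2 i (hST hi)) hc ?_
    intro i hi
    by_cases hT : i ∈ T
    · rw [← h1 i hT, ← h2 i hT, hc i hi]
    · exact h4 i hT
  · push Not at hc
    obtain ⟨i, hi, hne⟩ := hc
    rw [h.1 σ τ ⟨i, hi, hne⟩, h.1 σ' τ' ⟨i, hi, ?_⟩]
    by_cases hT : i ∈ T
    · rw [← h1 i hT, ← h2 i hT]; exact hne
    · exact absurd (h3 i hT) hne

lemma actsOn_add {n : ℕ} {S : Finset (Fin n)} {M N : QOp n} (h : ActsOn S M) (h' : ActsOn S N) :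
    ActsOn S (M + N) := by
  refine ⟨fun σ τ hx => ?_, fun σ τ σ' τ' h1 h2 h3 h4 => ?_⟩
  · rw [Matrix.add_apply, h.1 σ τ hx, h'.1 σ τ hx, add_zero]
  · rw [Matrix.add_apply, Matrix.add_apply, h.2 σ τ σ' τ' h1 h2 h3 h4, h'.2 σ τ σ' τ' h1 h2 h3 h4]

def pairCfg {n : ℕ} (s t : Fin n) (x : Fin 2 × Fin 2) : Fin n → Fin 2 :=
  fun i => if i = s then x.1 else if i = t then x.2 else 0

lemma pairCfg_inj {n : ℕ} {s t : Fin n} (hst : s ≠ t) : Function.Injective (pairCfg s t) := by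
  intro x y h
  have h1 := congrFun h s
  have h2 := congrFun h t
  simp [pairCfg, hst.symm] at h1 h2
  exact Prod.ext h1 h2

lemma loc_apply {n : ℕ} {s t : Fin n} (hst : s ≠ t) {M : QOp n} (h : ActsOn {s, t} M)
    (σ τ : Fin n → Fin 2) :
    M σ τ = if (∀ i, i ≠ s → i ≠ t → σ i = τ i) then
      M (pairCfg s t (σ s, σ t)) (pairCfg s t (τ s, τ t)) else 0 := by
  split_ifs with hc
  · apply h.2
    · intro i hi
      simp only [Finset.mem_insert, Finset.mem_singleton] at hi
      rcases hi with rfl | rfl <;> simp [pairCfg, hst.symm]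
    · intro i hi
      simp only [Finset.mem_insert, Finset.mem_singleton] at hi
      rcases hi with rfl | rfl <;> simp [pairCfg, hst.symm]
    · intro i hi
      simp only [Finset.mem_insert, Finset.mem_singleton, not_or] at hi
      exact hc i hi.1 hi.2
    · intro i hi
      simp only [Finset.mem_insert, Finset.mem_singleton, not_or] at hi
      simp [pairCfg, hi.1, hi.2]
  · push Not at hc
    obtain ⟨i, h1, h2, h3⟩ := hc
    exact h.1 _ _ ⟨i, by simp [h1, h2], h3⟩

lemma loc_trace {n : ℕ} {s t : Fin n} (hst : s ≠ t) {M : QOp n} (h : ActsOn {s, t} M)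
    (htr : M.trace = 0) : (M.submatrix (pairCfg s t) (pairCfg s t)).trace = 0 := by
  set g : Fin 2 × Fin 2 → ℂ := fun x => M (pairCfg s t x) (pairCfg s t x) with hg
  have h1 : ∑ σ : Fin n → Fin 2, g (σ s, σ t) = 0 := by
    rw [← htr, Matrix.trace]
    refine Finset.sum_congr rfl fun σ _ => ?_
    rw [Matrix.diag_apply, loc_apply hst h]
    simp [hg]
  have h2 : ∀ x : Fin 2 × Fin 2, ∑ σ : Fin n → Fin 2, g ((σ s, σ t) + x) = 0 := by
    intro x
    rw [← h1, ← Equiv.sum_comp (Equiv.addRight (pairCfg s t x)) (fun σ : Fin n → Fin 2 => g (σ s, σ t))]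
    refine Finset.sum_congr rfl fun σ _ => ?_
    congr 1
    ext <;> simp [pairCfg, hst.symm]
  have h3 : ∑ x, ∑ σ : Fin n → Fin 2, g ((σ s, σ t) + x) = 0 := Finset.sum_eq_zero fun x _ => h2 x
  rw [Finset.sum_comm] at h3
  have h4 : ∀ σ : Fin n → Fin 2, ∑ x, g ((σ s, σ t) + x) = ∑ x, g x := fun σ =>
    Equiv.sum_comp (Equiv.addLeft (σ s, σ t)) g
  simp only [h4, Finset.sum_const, nsmul_eq_mul] at h3
  rcases mul_eq_zero.1 h3 with h5 | h5
  · simp at h5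
  · exact h5

lemma loc_eig {n : ℕ} {s t : Fin n} (hst : s ≠ t) {M : QOp n}
    (hM : opNorm M ≤ 1) (hh : (M.submatrix (pairCfg s t) (pairCfg s t)).IsHermitian)
    (x : Fin 2 × Fin 2) : |hh.eigenvalues x| ≤ 1 := by
  set u : Fin 2 × Fin 2 → ℂ := ⇑(hh.eigenvectorBasis x) with hu
  have hev : (M.submatrix (pairCfg s t) (pairCfg s t)) *ᵥ u = hh.eigenvalues x • u :=
    hh.mulVec_eigenvectorBasis x
  have hu1 : ∑ y, star (u y) * u y = 1 := by
    have h1 : inner ℂ (hh.eigenvectorBasis x) (hh.eigenvectorBasis x) = (1 : ℂ) := by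
      have := hh.eigenvectorBasis.orthonormal.1 x
      rw [inner_self_eq_norm_sq_to_K, this]; simp
    rw [PiLp.inner_apply] at h1
    rw [← h1]
    refine Finset.sum_congr rfl fun y _ => ?_
    rw [RCLike.inner_apply, mul_comm]; rfl
  set ψ : (Fin n → Fin 2) → ℂ := fun σ => ∑ y, if σ = pairCfg s t y then u y else 0 with hψ
  have hsum : ∀ F : (Fin n → Fin 2) → ℂ, ∑ σ, F σ * ψ σ = ∑ y, F (pairCfg s t y) * u y := by
    intro F
    simp only [hψ, Finset.mul_sum]
    rw [Finset.sum_comm]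
    simp
  have hsum' : ∀ F : (Fin n → Fin 2) → ℂ, ∑ σ, star (ψ σ) * F σ = ∑ y, star (u y) * F (pairCfg s t y) := by
    intro F
    have := congrArg star (hsum (fun σ => star (F σ)))
    simpa [star_sum, mul_comm] using this
  have hψc : ∀ y, ψ (pairCfg s t y) = u y := by
    intro y
    simp [hψ, (pairCfg_inj hst).eq_iff]
  set Ψ : EuclideanSpace ℂ (Fin n → Fin 2) := WithLp.toLp 2 ψ with hΨ
  have hn : ‖Ψ‖ = 1 := by
    have h1 : inner ℂ Ψ Ψ = (1 : ℂ) := by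
      rw [PiLp.inner_apply, ← hu1]
      rw [← Finset.sum_congr rfl fun y _ => congrArg (star (u y) * ·) (hψc y), ← hsum']
      refine Finset.sum_congr rfl fun y _ => ?_
      rw [RCLike.inner_apply, mul_comm]; rfl
    rw [inner_self_eq_norm_sq_to_K] at h1
    have h2 : ‖Ψ‖ ^ 2 = 1 := by
      apply Complex.ofReal_injective
      push_cast
      exact h1
    nlinarith [norm_nonneg Ψ]
  have hin : inner ℂ Ψ (Matrix.toEuclideanLin M Ψ) = (hh.eigenvalues x : ℂ) := by
    rw [PiLp.inner_apply]
    have e1 : ∀ σ, inner ℂ (Ψ σ) ((Matrix.toEuclideanLin M Ψ) σ) = star (ψ σ) * (M *ᵥ ψ) σ := by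
      intro σ
      simp [hΨ, Matrix.toLpLin_apply, mul_comm]
    simp only [e1]
    rw [hsum']
    have e2 : ∀ y, (M *ᵥ ψ) (pairCfg s t y) = (hh.eigenvalues x : ℂ) * u y := by
      intro y
      have := congrFun hev y
      simp only [Matrix.mulVec, dotProduct] at this ⊢
      rw [hsum]
      simpa using this
    simp only [e2]
    calc _ = (hh.eigenvalues x : ℂ) * ∑ y, star (u y) * u y := by
          rw [Finset.mul_sum]
          exact Finset.sum_congr rfl fun y _ => by ring
      _ = _ := by rw [hu1, mul_one]
  have hle := norm_inner_le_norm (𝕜 := ℂ) Ψ (Matrix.toEuclideanLin M Ψ)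
  rw [hin, hn, one_mul] at hle
  have h2 := (LinearMap.toContinuousLinearMap (Matrix.toEuclideanLin M)).le_opNorm Ψ
  rw [hn, mul_one] at h2
  have h3 : ‖((hh.eigenvalues x : ℝ) : ℂ)‖ = |hh.eigenvalues x| := by simp
  rw [h3] at hle
  exact hle.trans (h2.trans hM)

def joinEquiv (n m : ℕ) (hmn : m ≤ n) :
    ((Fin m → Fin 2) × (Fin (n - m) → Fin 2)) ≃ (Fin n → Fin 2) where
  toFun p := joinCfg n m p.1 p.2
  invFun σ := (fun i => σ ⟨i, by have := i.isLt; omega⟩, fun j => σ ⟨m + j, by have := j.isLt; omega⟩)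
  left_inv p := by
    ext i <;> simp [joinCfg]
  right_inv σ := by
    ext i
    simp only [joinCfg]
    split_ifs with h
    · rfl
    · have e : (⟨m + ((i : ℕ) - m), by have := i.isLt; omega⟩ : Fin n) = i := by
        ext; simp only; omega
      rw [e]

def pairEquiv (M m : ℕ) (hm : m = M + M) : (Fin m → Fin 2) ≃ (Fin M → Fin 2 × Fin 2) where
  toFun a k := (a ⟨2 * k, by have := k.isLt; omega⟩, a ⟨2 * k + 1, by have := k.isLt; omega⟩)
  invFun l i := if (i : ℕ) % 2 = 0 then (l ⟨i / 2, by have := i.isLt; omega⟩).1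
    else (l ⟨i / 2, by have := i.isLt; omega⟩).2
  left_inv a := by
    funext i
    dsimp only
    split_ifs with h
    · congr 1; ext; simp only; omega
    · congr 1; ext; simp only; omega
  right_inv l := by
    funext k
    have h1 : (2 * (k : ℕ) + 1) / 2 = k := by omega
    have h2 : (2 * (k : ℕ) + 1) % 2 = 1 := by omega
    ext <;> simp [h1, h2]

lemma finSucc_inj {n : ℕ} : Function.Injective (finSucc (n := n)) := by
  intro a b h
  have h := congrArg Fin.val h
  simp only [finSucc] at h
  have ha := a.isLt
  have hb := b.isLt
  ext
  rcases (show (a : ℕ) + 1 < n ∨ (a : ℕ) + 1 = n by omega) with h1 | h1 <;>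
  rcases (show (b : ℕ) + 1 < n ∨ (b : ℕ) + 1 = n by omega) with h2 | h2
  · rw [Nat.mod_eq_of_lt h1, Nat.mod_eq_of_lt h2] at h; omega
  · rw [Nat.mod_eq_of_lt h1, h2, Nat.mod_self] at h; omega
  · rw [Nat.mod_eq_of_lt h2, h1, Nat.mod_self] at h; omega
  · omega

lemma shiftCfg_bij {n : ℕ} : Function.Bijective (shiftCfg (n := n)) := by
  apply Function.Injective.bijective_of_finite
  intro σ τ h
  exact (Finite.injective_iff_surjective.1 (finSucc_inj (n := n))).injective_comp_right h

def qexpect {n : ℕ} (M : QOp n) (ψ : QState n) : ℂ := ∑ σ, ∑ τ, star (ψ σ) * M σ τ * ψ τ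

lemma qexpect_shift {n : ℕ} (M M' : QOp n) (ψ : QState n)
    (hM : ∀ σ τ, M' σ τ = M (shiftCfg σ) (shiftCfg τ))
    (h1 : ∑ σ, star (ψ σ) * ψ σ = 1) (c : ℂ) (hc : ∀ σ, ψ (shiftCfg σ) = c * ψ σ) :
    qexpect M' ψ = qexpect M ψ := by
  have hcc : star c * c = 1 := by
    have := shiftCfg_bij.sum_comp (fun σ : Fin n → Fin 2 => star (ψ σ) * ψ σ)
    simp only [hc, star_mul'] at this
    rw [h1] at this
    rw [← this]
    calc star c * c = star c * c * ∑ σ, star (ψ σ) * ψ σ := by rw [h1, mul_one]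
      _ = _ := by rw [Finset.mul_sum]; exact Finset.sum_congr rfl fun _ _ => by ring
  unfold qexpect
  rw [← shiftCfg_bij.sum_comp (fun σ : Fin n → Fin 2 => ∑ τ, star (ψ σ) * M σ τ * ψ τ)]
  refine Finset.sum_congr rfl fun σ _ => ?_
  rw [← shiftCfg_bij.sum_comp (fun τ : Fin n → Fin 2 => star (ψ (shiftCfg σ)) * M (shiftCfg σ) τ * ψ τ)]
  refine Finset.sum_congr rfl fun τ _ => ?_
  rw [hM, hc, hc, star_mul']
  linear_combination (-(star (ψ σ) * M (shiftCfg σ) (shiftCfg τ) * ψ τ)) * hcc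

lemma prod_delta {K β : Type} [Fintype K] [DecidableEq K] [DecidableEq β]
    (k : K) (h : K → Matrix β β ℂ) (x y : K → β)
    [Decidable (∀ k', k' ≠ k → x k' = y k')] :
    (∏ k', if k' = k then h k' (x k') (y k') else if x k' = y k' then (1 : ℂ) else 0) =
      if ∀ k', k' ≠ k → x k' = y k' then h k (x k) (y k) else 0 := by
  split_ifs with hc
  · rw [Finset.prod_eq_single k]
    · simp
    · intro k' _ hk; simp [hk, hc k' hk]
    · simp
  · push Not at hc
    obtain ⟨k', h1, h2⟩ := hc
    exact Finset.prod_eq_zero (Finset.mem_univ k') (by simp [h1, h2])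

lemma join_cond (n m M : ℕ) (hm : m = M + M) (hmn : m ≤ n) (k : Fin M)
    (s t : Fin n) (hs : (s : ℕ) = 2 * k) (ht : (t : ℕ) = 2 * k + 1)
    (a a' : Fin m → Fin 2) (b b' : Fin (n - m) → Fin 2) :
    (∀ i, i ≠ s → i ≠ t → joinCfg n m a b i = joinCfg n m a' b' i) ↔
      (b = b' ∧ ∀ k', k' ≠ k → pairEquiv M m hm a k' = pairEquiv M m hm a' k') := by
  have hk := k.isLt
  constructor
  · intro h
    constructor
    · funext j
      have hj := j.isLt
      have := h ⟨m + j, by omega⟩ (by rw [Ne, Fin.ext_iff]; simp only; omega)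
        (by rw [Ne, Fin.ext_iff]; simp only; omega)
      simpa [joinCfg] using this
    · intro k' hk'
      have hk2 := k'.isLt
      have hne : (k' : ℕ) ≠ k := fun h => hk' (Fin.ext h)
      have h1 := h ⟨2 * k', by omega⟩ (by rw [Ne, Fin.ext_iff]; simp only; omega)
        (by rw [Ne, Fin.ext_iff]; simp only; omega)
      have h2 := h ⟨2 * k' + 1, by omega⟩ (by rw [Ne, Fin.ext_iff]; simp only; omega)
        (by rw [Ne, Fin.ext_iff]; simp only; omega)
      simp only [joinCfg] at h1 h2
      rw [dif_pos (by omega), dif_pos (by omega)] at h1 h2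
      exact Prod.ext h1 h2
  · rintro ⟨rfl, h⟩ i his hit
    simp only [joinCfg]
    split_ifs with hi
    · have h1 : (i : ℕ) ≠ s := fun h => his (Fin.ext h)
      have h2 : (i : ℕ) ≠ t := fun h => hit (Fin.ext h)
      have := h ⟨i / 2, by omega⟩ (by rw [Ne, Fin.ext_iff]; simp only; omega)
      simp only [pairEquiv, Equiv.coe_fn_mk, Prod.mk.injEq] at this
      rcases Nat.mod_two_eq_zero_or_one i with h3 | h3
      · have e : (⟨i, hi⟩ : Fin m) = ⟨2 * (i / 2), by omega⟩ := by ext; simp only; omega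
        rw [e]; exact this.1
      · have e : (⟨i, hi⟩ : Fin m) = ⟨2 * (i / 2) + 1, by omega⟩ := by ext; simp only; omega
        rw [e]; exact this.2
    · rfl

lemma qexpect_rdm (n m M : ℕ) (hm : m = M + M) (hmn : m ≤ n) (k : Fin M)
    (s t : Fin n) (hs : (s : ℕ) = 2 * k) (ht : (t : ℕ) = 2 * k + 1)
    (Q : QOp n) (hQ : ActsOn {s, t} Q) (ψ : QState n) :
    ∑ a, ∑ a', rdm n m ψ a a' *
      (if ∀ k', k' ≠ k → pairEquiv M m hm a' k' = pairEquiv M m hm a k' then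
        (Q.submatrix (pairCfg s t) (pairCfg s t)) (pairEquiv M m hm a' k) (pairEquiv M m hm a k)
        else 0) = qexpect Q ψ := by
  have hk := k.isLt
  have hst : s ≠ t := by rw [Ne, Fin.ext_iff]; omega
  unfold qexpect
  rw [← Equiv.sum_comp (joinEquiv n m hmn), Fintype.sum_prod_type]
  have e1 : ∀ a' b' a b, Q (joinCfg n m a' b') (joinCfg n m a b) =
      if b' = b then (if ∀ k', k' ≠ k → pairEquiv M m hm a' k' = pairEquiv M m hm a k' then
        (Q.submatrix (pairCfg s t) (pairCfg s t)) (pairEquiv M m hm a' k) (pairEquiv M m hm a k)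
        else 0) else 0 := by
    intro a' b' a b
    rw [loc_apply hst hQ]
    simp only [join_cond n m M hm hmn k s t hs ht]
    have e2 : ∀ a b, (joinCfg n m a b s, joinCfg n m a b t) = pairEquiv M m hm a k := by
      intro a b
      simp only [joinCfg]
      rw [dif_pos (by omega), dif_pos (by omega)]
      simp only [pairEquiv, Equiv.coe_fn_mk, hs, ht]
    rw [e2, e2, ← ite_and]
    rfl
  rw [Finset.sum_comm]
  refine Finset.sum_congr rfl fun a' _ => ?_
  have e3 : ∀ b', ∑ τ, star (ψ (joinEquiv n m hmn (a', b'))) * Q (joinEquiv n m hmn (a', b')) τ * ψ τ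
      = ∑ a, ψ (joinCfg n m a b') * star (ψ (joinCfg n m a' b')) * (if ∀ k', k' ≠ k → pairEquiv M m hm a' k' = pairEquiv M m hm a k' then
        (Q.submatrix (pairCfg s t) (pairCfg s t)) (pairEquiv M m hm a' k) (pairEquiv M m hm a k)
        else 0) := by
    intro b'
    rw [← Equiv.sum_comp (joinEquiv n m hmn), Fintype.sum_prod_type]
    refine Finset.sum_congr rfl fun a _ => ?_
    simp only [joinEquiv, Equiv.coe_fn_mk, e1]
    rw [Finset.sum_eq_single b']
    · rw [if_pos rfl]; ring
    · intro b _ hb; rw [if_neg hb.symm]; ring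
    · simp
  simp only [e3]
  rw [Finset.sum_comm]
  refine Finset.sum_congr rfl fun a _ => ?_
  simp only [rdm, Finset.sum_mul]
  rfl

lemma rdm_psd (n m : ℕ) (ψ : QState n) : (rdm n m ψ).PosSemidef := by
  have : rdm n m ψ = (Matrix.of fun a b => ψ (joinCfg n m a b)) *
      (Matrix.of fun a b => ψ (joinCfg n m a b))ᴴ := by
    ext a a'
    simp [rdm, Matrix.mul_apply]
  rw [this]
  exact Matrix.posSemidef_self_mul_conjTranspose _

lemma rdm_trace (n m : ℕ) (hmn : m ≤ n) (ψ : QState n) (h1 : ∑ σ, star (ψ σ) * ψ σ = 1) :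
    (rdm n m ψ).trace = 1 := by
  rw [← h1, ← Equiv.sum_comp (joinEquiv n m hmn), Fintype.sum_prod_type]
  refine Finset.sum_congr rfl fun a _ => Finset.sum_congr rfl fun b _ => ?_
  simp [joinEquiv, mul_comm]

/-- **Lemma 1 (eigenstate entanglement bound).** For a translationally invariant local
Hamiltonian `H = ∑ᵢ Hᵢ`, `Hᵢ = H'ᵢ + H'_{i,i+1}`, with traceless, pairwise trace-orthogonal,
unit-norm local terms, every translationally invariant eigenstate `|j⟩` with eigenvalue `E j`
satisfies `S(ρ_{j,A}) ≤ m ln 2 - f E_j² / (4n)` where `A` is the first `m` spins, `f = m/n ≤ 1/2`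
and `m` is even. -/
theorem eigenstate_entanglement_upper_bound
    (n m : ℕ) (hn : 0 < n) (hmeven : Even m) (hmn : 2 * m ≤ n)
    (H1 H2 : Fin n → QOp n)
    (hloc1 : ∀ i, ActsOn {i} (H1 i))
    (hloc2 : ∀ i, ActsOn {i, finSucc i} (H2 i))
    (hherm1 : ∀ i, (H1 i).IsHermitian) (hherm2 : ∀ i, (H2 i).IsHermitian)
    (htr1 : ∀ i, (H1 i).trace = 0) (htr2 : ∀ i, (H2 i).trace = 0)
    (horth : ∀ i i', i ≠ i' → ((H1 i + H2 i) * (H1 i' + H2 i')).trace = 0)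
    (hnorm : ∀ i, opNorm (H1 i + H2 i) = 1)
    (hTIH1 : ∀ i σ τ, H1 (finSucc i) σ τ = H1 i (shiftCfg σ) (shiftCfg τ))
    (hTIH2 : ∀ i σ τ, H2 (finSucc i) σ τ = H2 i (shiftCfg σ) (shiftCfg τ))
    (v : (Fin n → Fin 2) → QState n) (E : (Fin n → Fin 2) → ℝ)
    (hON : ∀ j j', ∑ σ, (starRingEnd ℂ) (v j σ) * v j' σ = if j = j' then 1 else 0)
    (heig : ∀ j, (∑ i, (H1 i + H2 i)).mulVec (v j) = (E j : ℂ) • v j)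
    (hTIv : ∀ j, ∃ c : ℂ, ∀ σ, v j (shiftCfg σ) = c * v j σ) :
    ∀ j, entEntropy n m (v j) ≤ m * Real.log 2 - ((m : ℝ) / n) * (E j) ^ 2 / (4 * n) := by
  intro j
  set ψ := v j with hψ
  have hψ1 : ∑ σ, star (ψ σ) * ψ σ = 1 := by
    have := hON j j
    rw [if_pos rfl] at this
    exact this
  obtain ⟨c, hc⟩ := hTIv j
  set Q : Fin n → QOp n := fun i => H1 i + H2 i with hQ
  have hact : ∀ i, ActsOn {i, finSucc i} (Q i) := fun i =>
    actsOn_add (actsOn_mono (by simp) (hloc1 i)) (hloc2 i)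
  have hstep : ∀ i, qexpect (Q (finSucc i)) ψ = qexpect (Q i) ψ := fun i =>
    qexpect_shift (Q i) (Q (finSucc i)) ψ
      (fun σ τ => by simp only [hQ, Matrix.add_apply, hTIH1, hTIH2]) hψ1 c hc
  have hconst : ∀ k (hk : k < n), qexpect (Q ⟨k, hk⟩) ψ = qexpect (Q ⟨0, hn⟩) ψ := by
    intro k
    induction k with
    | zero => intro _; rfl
    | succ k ih =>
      intro hk
      rw [← ih (by omega), ← hstep ⟨k, by omega⟩]
      have e : (⟨k + 1, hk⟩ : Fin n) = finSucc ⟨k, by omega⟩ := by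
        ext
        simp only [finSucc]
        exact (Nat.mod_eq_of_lt hk).symm
      rw [e]
  have hsumE : ∑ i, qexpect (Q i) ψ = (E j : ℂ) := by
    have h1 : ∑ σ, star (ψ σ) * ((∑ i, Q i) *ᵥ ψ) σ = (E j : ℂ) := by
      rw [heig j]
      calc _ = (E j : ℂ) * ∑ σ, star (ψ σ) * ψ σ := by
            rw [Finset.mul_sum]
            refine Finset.sum_congr rfl fun σ _ => ?_
            simp only [Pi.smul_apply, smul_eq_mul, hψ]; ring
        _ = _ := by rw [hψ1, mul_one]
    rw [← h1]
    simp only [qexpect, Matrix.mulVec, dotProduct, Matrix.sum_apply, Finset.mul_sum, Finset.sum_mul]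
    rw [Finset.sum_comm]
    refine Finset.sum_congr rfl fun σ _ => ?_
    rw [Finset.sum_comm]
    exact Finset.sum_congr rfl fun τ _ => Finset.sum_congr rfl fun i _ => by ring
  have hn0 : (n : ℂ) ≠ 0 := by exact_mod_cast hn.ne'
  have hex : ∀ i, qexpect (Q i) ψ = ((E j / n : ℝ) : ℂ) := by
    intro i
    have h2 : ∀ i, qexpect (Q i) ψ = qexpect (Q ⟨0, hn⟩) ψ := fun i => hconst i i.isLt
    simp only [h2] at hsumE ⊢
    simp only [Finset.sum_const, Finset.card_univ, Fintype.card_fin, nsmul_eq_mul] at hsumE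
    push_cast
    rw [← hsumE]
    field_simp
  obtain ⟨M, hm⟩ := hmeven
  have hmn' : m ≤ n := by omega
  let s : Fin M → Fin n := fun k => ⟨2 * k, by have := k.isLt; omega⟩
  have hsucc : ∀ k : Fin M, ((finSucc (s k) : Fin n) : ℕ) = 2 * k + 1 := by
    intro k
    have := k.isLt
    have h2 : 2 * (k : ℕ) + 1 < n := by omega
    exact Nat.mod_eq_of_lt h2
  have hne : ∀ k : Fin M, s k ≠ finSucc (s k) := by
    intro k h
    have h1 := congrArg Fin.val h
    rw [hsucc] at h1
    simp only [s] at h1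
    omega
  have hherm : ∀ k : Fin M, ((Q (s k)).submatrix (pairCfg (s k) (finSucc (s k)))
      (pairCfg (s k) (finSucc (s k)))).IsHermitian := fun k =>
    ((hherm1 _).add (hherm2 _)).submatrix _
  have hb := product_bound (pairEquiv M m hm) (rdm n m ψ) (rdm_psd n m ψ)
    (rdm_trace n m hmn' ψ hψ1)
    (fun k => (Q (s k)).submatrix (pairCfg (s k) (finSucc (s k))) (pairCfg (s k) (finSucc (s k))))
    hherm
    (fun k => loc_trace (hne k) (hact _) (by simp only [hQ, Matrix.trace_add, htr1, htr2, add_zero]))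
    (fun k x => loc_eig (hne k) (hnorm _).le (hherm k) x)
    (E j / n)
    (fun k => by
      simp only [prod_delta k (fun k => (Q (s k)).submatrix (pairCfg (s k) (finSucc (s k)))
        (pairCfg (s k) (finSucc (s k))))]
      rw [← hex (s k)]
      convert qexpect_rdm n m M hm hmn' k (s k) (finSucc (s k)) rfl (hsucc k) (Q (s k)) (hact _) ψ)
  unfold entEntropy
  refine hb.trans (le_of_eq ?_)
  have h4 : Real.log ((Fintype.card (Fin 2 × Fin 2) : ℕ) : ℝ) = 2 * Real.log 2 := by
    rw [show ((Fintype.card (Fin 2 × Fin 2) : ℕ) : ℝ) = 2 ^ 2 by simp; norm_num, Real.log_pow]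
    norm_num
  have hnr : (n : ℝ) ≠ 0 := by exact_mod_cast hn.ne'
  rw [h4, Fintype.card_fin, hm]
  push_cast
  field_simp
  ring
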